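/- Disjunctive normal form over modal literals (Proposition 2 of the paper, first part): every formula Φ ∈ L_M is logically equivalent to a finite disjunction of finite conjunctions of modal literals of the form [y_1][y_2]…[y_{k-1}][x]A, where k ≥ 1, y_1, …, y_{k-1} ∈ {0,1}, x ∈ X, and A ∈ H (with the empty disjunction taken to be 0 and the empty conjunction taken to be 1): there exists such a disjunction D with 𝔉(v)(Φ) = 𝔉(v)(D) for every many-valued valuation v. -/

import Mathlib

/-- Propositional formulas of the many-valued logic `L`, generated from atoms in `H`
by unary connectives indexed by `U` and binary connectives indexed by `B`. -/
inductive Fml (H U B : Type) : Type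
  | atom : H → Fml H U B
  | un : U → Fml H U B → Fml H U B
  | bin : B → Fml H U B → Fml H U B → Fml H U B

/-- The multi-modal 2-valued language `L_M`. -/
inductive MFml (X H U B : Type) : Type
  | bot : MFml X H U B
  | top : MFml X H U B
  | box : X → Fml H U B → MFml X H U B
  | bbox : Bool → MFml X H U B → MFml X H U B
  | and : MFml X H U B → MFml X H U B → MFml X H U B
  | or : MFml X H U B → MFml X H U B → MFml X H U B

variable {X H U B : Type}

/-- Homomorphic extension of a many-valued valuation `v : H → X` to all formulas,
where the unary connective `u` is interpreted by `su u` and the binary connective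
`c` by `bo c`. -/
def mvVal (su : U → X → X) (bo : B → X → X → X) (v : H → X) : Fml H U B → X
  | .atom a => v a
  | .un u φ => su u (mvVal su bo v φ)
  | .bin c φ ψ => bo c (mvVal su bo v φ) (mvVal su bo v ψ)

/-- The modal valuation `𝔉(v) : L_M → 2`. -/
def mval [DecidableEq X] (su : U → X → X) (bo : B → X → X → X) (v : H → X) :
    MFml X H U B → Bool
  | .bot => false
  | .top => true
  | .box x φ => decide (mvVal su bo v φ = x)
  | .bbox b Φ => decide (mval su bo v Φ = b)
  | .and Φ Ψ => mval su bo v Φ && mval su bo v Ψ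
  | .or Φ Ψ => mval su bo v Φ || mval su bo v Ψ

/-- Finite disjunction (empty disjunction is `0`). -/
def bigOr : List (MFml X H U B) → MFml X H U B
  | [] => .bot
  | Φ :: l => .or Φ (bigOr l)

/-- Finite conjunction (empty conjunction is `1`). -/
def bigAnd : List (MFml X H U B) → MFml X H U B
  | [] => .top
  | Φ :: l => .and Φ (bigAnd l)

/-- `⋁_{y ∈ X : x = s(y)} [y]φ`. -/
noncomputable def unDisj [Fintype X] [DecidableEq X] (su : U → X → X) (x : X) (u : U)
    (φ : Fml H U B) : MFml X H U B :=
  bigOr (((Finset.univ.filter fun y => x = su u y)).toList.map fun y => .box y φ)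

/-- `⋁_{(y,z) ∈ X×X : x = o(y,z)} ([y]φ ∧ [z]ψ)`. -/
noncomputable def binDisj [Fintype X] [DecidableEq X] (bo : B → X → X → X) (x : X) (c : B)
    (φ ψ : Fml H U B) : MFml X H U B :=
  bigOr (((Finset.univ.filter fun p : X × X => x = bo c p.1 p.2)).toList.map
    fun p => .and (.box p.1 φ) (.box p.2 ψ))

/-- `⋁_{(b1,b2) ∈ 2×2 : b = op(b1,b2)} ([b1]Φ ∧ [b2]Ψ)`. -/
noncomputable def boolDisj (op : Bool → Bool → Bool) (b : Bool) (Φ Ψ : MFml X H U B) : MFml X H U B :=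
  bigOr (((Finset.univ.filter fun p : Bool × Bool => b = op p.1 p.2)).toList.map
    fun p => .and (.bbox p.1 Φ) (.bbox p.2 Ψ))

/-- The derivability relation `Γ ⊩ (Φ ⊢ Ψ)` of the Gentzen system `G`. -/
inductive Deriv [Fintype X] [DecidableEq X] (su : U → X → X) (bo : B → X → X → X)
    (Γ : Set (MFml X H U B × MFml X H U B)) : MFml X H U B → MFml X H U B → Prop
  | hyp {Φ Ψ} : (Φ, Ψ) ∈ Γ → Deriv su bo Γ Φ Ψ
  | refl (Φ) : Deriv su bo Γ Φ Φ
  | top (Φ) : Deriv su bo Γ Φ .top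
  | bot (Φ) : Deriv su bo Γ .bot Φ
  | andE1 (Φ Ψ) : Deriv su bo Γ (.and Φ Ψ) Φ
  | andE2 (Φ Ψ) : Deriv su bo Γ (.and Φ Ψ) Ψ
  | orI1 (Φ Ψ) : Deriv su bo Γ Φ (.or Φ Ψ)
  | orI2 (Φ Ψ) : Deriv su bo Γ Φ (.or Ψ Φ)
  | distrib (Φ Ψ Υ) :
      Deriv su bo Γ (.and Φ (.or Ψ Υ)) (.or (.and Φ Ψ) (.and Φ Υ))
  | introBoolAnd (b Φ Ψ) :
      Deriv su bo Γ (boolDisj (· && ·) b Φ Ψ) (.bbox b (.and Φ Ψ))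
  | introBoolOr (b Φ Ψ) :
      Deriv su bo Γ (boolDisj (· || ·) b Φ Ψ) (.bbox b (.or Φ Ψ))
  | introUn (x u φ) : Deriv su bo Γ (unDisj su x u φ) (.box x (.un u φ))
  | introBin (x c φ ψ) : Deriv su bo Γ (binDisj bo x c φ ψ) (.box x (.bin c φ ψ))
  | elimBoolAnd (b Φ Ψ) :
      Deriv su bo Γ (.bbox b (.and Φ Ψ)) (boolDisj (· && ·) b Φ Ψ)
  | elimBoolOr (b Φ Ψ) :
      Deriv su bo Γ (.bbox b (.or Φ Ψ)) (boolDisj (· || ·) b Φ Ψ)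
  | elimUn (x u φ) : Deriv su bo Γ (.box x (.un u φ)) (unDisj su x u φ)
  | elimBin (x c φ ψ) : Deriv su bo Γ (.box x (.bin c φ ψ)) (binDisj bo x c φ ψ)
  | cut {Φ Ψ Υ} : Deriv su bo Γ Φ Ψ → Deriv su bo Γ Ψ Υ → Deriv su bo Γ Φ Υ
  | lowerBound {Φ Ψ Υ} :
      Deriv su bo Γ Φ Ψ → Deriv su bo Γ Φ Υ → Deriv su bo Γ Φ (.and Ψ Υ)
  | upperBound {Φ Ψ Υ} :
      Deriv su bo Γ Φ Ψ → Deriv su bo Γ Υ Ψ → Deriv su bo Γ (.or Φ Υ) Ψ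

/-- Formulas of `L_M` with no nested modal operators. -/
inductive NoNest : MFml X H U B → Prop
  | bot : NoNest .bot
  | top : NoNest .top
  | box (x φ) : NoNest (.box x φ)
  | and {Φ Ψ} : NoNest Φ → NoNest Ψ → NoNest (.and Φ Ψ)
  | or {Φ Ψ} : NoNest Φ → NoNest Ψ → NoNest (.or Φ Ψ)

/-- The canonical reduct of `[x]φ` (Definition 3 of the paper). -/
noncomputable def reduct [Fintype X] [DecidableEq X] (su : U → X → X) (bo : B → X → X → X) :
    Fml H U B → X → MFml X H U B
  | .atom A, x => .box x (.atom A)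
  | .un u φ, x =>
      bigOr (((Finset.univ.filter fun y => x = su u y)).toList.map
        fun y => reduct su bo φ y)
  | .bin c φ ψ, x =>
      bigOr (((Finset.univ.filter fun p : X × X => x = bo c p.1 p.2)).toList.map
        fun p => .and (reduct su bo φ p.1) (reduct su bo ψ p.2))

/-- Homomorphic extension of a substitution `σ : H → L` to `L`. -/
def subFml (σ : H → Fml H U B) : Fml H U B → Fml H U B
  | .atom A => σ A
  | .un u φ => .un u (subFml σ φ)
  | .bin c φ ψ => .bin c (subFml σ φ) (subFml σ ψ)

/-- Extension `σ_M : L_M → L_M` of a substitution. -/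
def subM (σ : H → Fml H U B) : MFml X H U B → MFml X H U B
  | .bot => .bot
  | .top => .top
  | .box x φ => .box x (subFml σ φ)
  | .bbox b Φ => .bbox b (subM σ Φ)
  | .and Φ Ψ => .and (subM σ Φ) (subM σ Ψ)
  | .or Φ Ψ => .or (subM σ Φ) (subM σ Ψ)

/-- Satisfaction at a possible world of the autoreferential Kripke model
(worlds `W = X ⊕ 2`, accessibility `R_u = W × {u}`). -/
def sat (su : U → X → X) (bo : B → X → X → X) (v : H → X) :
    (X ⊕ Bool) → MFml X H U B → Prop
  | _, .bot => False
  | _, .top => True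
  | _, .box x φ => mvVal su bo v φ = x
  | _, .bbox b Φ => sat su bo v (Sum.inr b) Φ
  | w, .and Φ Ψ => sat su bo v w Φ ∧ sat su bo v w Ψ
  | w, .or Φ Ψ => sat su bo v w Φ ∨ sat su bo v w Ψ

/-- The sequent bivaluation `𝔅(v)`. -/
def biv [DecidableEq X] (su : U → X → X) (bo : B → X → X → X) (v : H → X)
    (s : MFml X H U B × MFml X H U B) : Bool :=
  decide (mval su bo v s.1 = (mval su bo v s.1 && mval su bo v s.2))

/-- Modal literal `[y₁]…[y_{k-1}][x]A`. -/
def modalLit (l : List Bool) (x : X) (A : H) : MFml X H U B :=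
  l.foldr (fun b Φ => MFml.bbox b Φ) (MFml.box x (Fml.atom A))

/-- The theory `T_v` determined by a many-valued valuation `v`. -/
def Tv (v : H → X) : Set (MFml X H U B × MFml X H U B) :=
  {s | ∃ (A : H) (x : X), v A = x ∧
      (s = (MFml.top, MFml.box x (Fml.atom A)) ∨
       s = (MFml.box x (Fml.atom A), MFml.top))} ∪
  {s | ∃ (A : H) (x : X), v A ≠ x ∧
      (s = (MFml.box x (Fml.atom A), MFml.bot) ∨
       s = (MFml.bot, MFml.box x (Fml.atom A)))}

/-- The derivability relation of the Gentzen system `G` extended with the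
substitution rule. -/
inductive DerivS [Fintype X] [DecidableEq X] (su : U → X → X) (bo : B → X → X → X)
    (Γ : Set (MFml X H U B × MFml X H U B)) : MFml X H U B → MFml X H U B → Prop
  | hyp {Φ Ψ} : (Φ, Ψ) ∈ Γ → DerivS su bo Γ Φ Ψ
  | refl (Φ) : DerivS su bo Γ Φ Φ
  | top (Φ) : DerivS su bo Γ Φ .top
  | bot (Φ) : DerivS su bo Γ .bot Φ
  | andE1 (Φ Ψ) : DerivS su bo Γ (.and Φ Ψ) Φ
  | andE2 (Φ Ψ) : DerivS su bo Γ (.and Φ Ψ) Ψ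
  | orI1 (Φ Ψ) : DerivS su bo Γ Φ (.or Φ Ψ)
  | orI2 (Φ Ψ) : DerivS su bo Γ Φ (.or Ψ Φ)
  | distrib (Φ Ψ Υ) :
      DerivS su bo Γ (.and Φ (.or Ψ Υ)) (.or (.and Φ Ψ) (.and Φ Υ))
  | introBoolAnd (b Φ Ψ) :
      DerivS su bo Γ (boolDisj (· && ·) b Φ Ψ) (.bbox b (.and Φ Ψ))
  | introBoolOr (b Φ Ψ) :
      DerivS su bo Γ (boolDisj (· || ·) b Φ Ψ) (.bbox b (.or Φ Ψ))
  | introUn (x u φ) : DerivS su bo Γ (unDisj su x u φ) (.box x (.un u φ))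
  | introBin (x c φ ψ) : DerivS su bo Γ (binDisj bo x c φ ψ) (.box x (.bin c φ ψ))
  | elimBoolAnd (b Φ Ψ) :
      DerivS su bo Γ (.bbox b (.and Φ Ψ)) (boolDisj (· && ·) b Φ Ψ)
  | elimBoolOr (b Φ Ψ) :
      DerivS su bo Γ (.bbox b (.or Φ Ψ)) (boolDisj (· || ·) b Φ Ψ)
  | elimUn (x u φ) : DerivS su bo Γ (.box x (.un u φ)) (unDisj su x u φ)
  | elimBin (x c φ ψ) : DerivS su bo Γ (.box x (.bin c φ ψ)) (binDisj bo x c φ ψ)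
  | cut {Φ Ψ Υ} : DerivS su bo Γ Φ Ψ → DerivS su bo Γ Ψ Υ → DerivS su bo Γ Φ Υ
  | lowerBound {Φ Ψ Υ} :
      DerivS su bo Γ Φ Ψ → DerivS su bo Γ Φ Υ → DerivS su bo Γ Φ (.and Ψ Υ)
  | upperBound {Φ Ψ Υ} :
      DerivS su bo Γ Φ Ψ → DerivS su bo Γ Υ Ψ → DerivS su bo Γ (.or Φ Υ) Ψ
  | subst {Φ Ψ} (σ : H → Fml H U B) :
      DerivS su bo Γ Φ Ψ → DerivS su bo Γ (subM σ Φ) (subM σ Ψ)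

/-- A set of valuations cut out by a disjunction of conjunctions of modal literals. -/
def DnfDefinable [DecidableEq X] (su : U → X → X) (bo : B → X → X → X)
    (S : Set (H → X)) : Prop :=
  ∃ LL : List (List (List Bool × X × H)), ∀ v : H → X,
    v ∈ S ↔ ∃ c ∈ LL, ∀ t ∈ c, mval su bo v (modalLit t.1 t.2.1 t.2.2) = true

theorem mval_bigOr_eq_true [DecidableEq X] (su : U → X → X) (bo : B → X → X → X) (v : H → X)
    (l : List (MFml X H U B)) :
    mval su bo v (bigOr l) = true ↔ ∃ Φ ∈ l, mval su bo v Φ = true := by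
  induction l with
  | nil => simp [bigOr, mval]
  | cons Φ l ih => simp [bigOr, mval, ih]

theorem mval_bigAnd_eq_true [DecidableEq X] (su : U → X → X) (bo : B → X → X → X) (v : H → X)
    (l : List (MFml X H U B)) :
    mval su bo v (bigAnd l) = true ↔ ∀ Φ ∈ l, mval su bo v Φ = true := by
  induction l with
  | nil => simp [bigAnd, mval]
  | cons Φ l ih => simp [bigAnd, mval, ih]

namespace DnfDefinable

variable [DecidableEq X] {su : U → X → X} {bo : B → X → X → X} {S T : Set (H → X)}

theorem empty : DnfDefinable su bo (∅ : Set (H → X)) := ⟨[], by simp⟩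

theorem univ : DnfDefinable su bo (Set.univ : Set (H → X)) := ⟨[[]], by simp⟩

theorem literal (l : List Bool) (x : X) (A : H) :
    DnfDefinable su bo {v : H → X | mval su bo v (modalLit l x A) = true} :=
  ⟨[[(l, x, A)]], fun v => by simp only [List.mem_singleton, exists_eq_left, forall_eq]; rfl⟩

theorem union (hS : DnfDefinable su bo S) (hT : DnfDefinable su bo T) :
    DnfDefinable su bo (S ∪ T) := by
  obtain ⟨L, hL⟩ := hS
  obtain ⟨M, hM⟩ := hT
  refine ⟨L ++ M, fun v => ?_⟩
  simp only [Set.mem_union, hL, hM, List.mem_append, or_and_right, exists_or]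

theorem inter (hS : DnfDefinable su bo S) (hT : DnfDefinable su bo T) :
    DnfDefinable su bo (S ∩ T) := by
  obtain ⟨L, hL⟩ := hS
  obtain ⟨M, hM⟩ := hT
  refine ⟨L.flatMap fun c => M.map fun d => c ++ d, fun v => ?_⟩
  simp only [Set.mem_inter_iff, hL, hM, List.mem_flatMap, List.mem_map]
  constructor
  · rintro ⟨⟨c, hc, hcv⟩, d, hd, hdv⟩
    refine ⟨c ++ d, ⟨c, hc, d, hd, rfl⟩, fun t ht => ?_⟩
    exact (List.mem_append.1 ht).elim (hcv t) (hdv t)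
  · rintro ⟨_, ⟨c, hc, d, hd, rfl⟩, h⟩
    exact ⟨⟨c, hc, fun t ht => h t (List.mem_append_left _ ht)⟩,
      d, hd, fun t ht => h t (List.mem_append_right _ ht)⟩

theorem compl (hS : DnfDefinable su bo S) : DnfDefinable su bo Sᶜ := by
  obtain ⟨L, hL⟩ := hS
  induction L generalizing S with
  | nil =>
    convert (univ : DnfDefinable su bo (Set.univ : Set (H → X))) using 1
    ext v
    simp [hL]
  | cons c L ih =>
    have hc : DnfDefinable su bo
        {v : H → X | ∀ t ∈ c, mval su bo v (modalLit t.1 t.2.1 t.2.2) = true}ᶜ := by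
      refine ⟨c.map fun t => [(false :: t.1, t.2)], fun v => ?_⟩
      have hneg (t : List Bool × X × H) :
          mval su bo v (modalLit (false :: t.1) t.2.1 t.2.2) = true ↔
            ¬ mval su bo v (modalLit t.1 t.2.1 t.2.2) = true := by
        rw [Bool.not_eq_true]
        exact decide_eq_true_iff
      simp only [Set.mem_compl_iff, Set.mem_ofPred_eq, not_forall, List.mem_map,
        exists_exists_and_eq_and, List.mem_singleton, forall_eq, hneg, exists_prop]
    convert hc.inter (ih (S := {v | ∃ c ∈ L, ∀ t ∈ c,
      mval su bo v (modalLit t.1 t.2.1 t.2.2) = true}) fun v => Iff.rfl) using 1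
    ext v
    simp only [Set.mem_compl_iff, hL, List.exists_mem_cons_iff, Set.mem_inter_iff,
      Set.mem_ofPred_eq, not_or]

theorem biUnion {ι : Type*} (s : Finset ι) {f : ι → Set (H → X)}
    (hf : ∀ i, DnfDefinable su bo (f i)) : DnfDefinable su bo (⋃ i ∈ s, f i) := by
  classical
  induction s using Finset.induction_on with
  | empty => simpa using empty
  | insert i s _ ih =>
    rw [Finset.set_biUnion_insert]
    exact (hf i).union ih

theorem box [Fintype X] (φ : Fml H U B) (x : X) :
    DnfDefinable su bo {v : H → X | mvVal su bo v φ = x} := by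
  induction φ generalizing x with
  | atom A =>
    convert literal (su := su) (bo := bo) [] x A using 1
    ext v
    exact (decide_eq_true_iff (p := v A = x)).symm
  | un u φ ih =>
    convert biUnion (Finset.univ.filter fun y => su u y = x) ih using 1
    ext v
    simp [mvVal]
  | bin c φ ψ ihφ ihψ =>
    convert biUnion (Finset.univ.filter fun p : X × X => bo c p.1 p.2 = x)
      (fun p => (ihφ p.1).inter (ihψ p.2)) using 1
    ext v
    simp [mvVal]

theorem of_formula [Fintype X] (su : U → X → X) (bo : B → X → X → X) (Φ : MFml X H U B) :
    DnfDefinable su bo {v : H → X | mval su bo v Φ = true} := by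
  induction Φ with
  | bot => simpa [mval] using empty
  | top => simpa [mval] using univ
  | box x φ => simpa [mval] using box φ x
  | bbox b Φ ih =>
    cases b with
    | false => simpa [mval, Set.compl_ofPred] using ih.compl
    | true => simpa [mval] using ih
  | and Φ Ψ ihΦ ihΨ => simpa [mval, Set.ofPred_and] using ihΦ.inter ihΨ
  | or Φ Ψ ihΦ ihΨ => simpa [mval, Set.ofPred_or] using ihΦ.union ihΨ

end DnfDefinable

/-- Disjunctive normal form over modal literals. -/
theorem dnf_over_modal_literals [Fintype X] [DecidableEq X]
    (su : U → X → X) (bo : B → X → X → X) (Φ : MFml X H U B) :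
    ∃ LL : List (List (List Bool × X × H)),
      ∀ v : H → X,
        mval su bo v Φ =
          mval su bo v
            (bigOr (LL.map fun c => bigAnd (c.map fun t => modalLit t.1 t.2.1 t.2.2))) := by
  obtain ⟨LL, hLL⟩ := DnfDefinable.of_formula su bo Φ
  refine ⟨LL, fun v => Bool.eq_iff_iff.2 ((hLL v).trans ?_)⟩
  simp only [mval_bigOr_eq_true, mval_bigAnd_eq_true, List.mem_map,
    exists_exists_and_eq_and, forall_exists_index, and_imp, forall_apply_eq_imp_iff₂]
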